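/- Let G be an r-regular graph and k ≥ 4. If the generalized k-connectivity κ_k(G) equals r − 1, then the generalized (k−1)-connectivity κ_{k−1}(G) also equals r − 1. -/

import Mathlib

/-- `T` is an `S`-tree of `G`: a subtree of `G` containing all of `S`. -/
def IsSTree {V : Type*} (G : SimpleGraph V) (S : Set V) (T : G.Subgraph) : Prop :=
  T.coe.IsTree ∧ S ⊆ T.verts

/-- There are `r` pairwise internally edge disjoint `S`-trees in `G`. -/
def HasIEDTrees {V : Type*} (G : SimpleGraph V) (S : Set V) (r : ℕ) : Prop :=
  ∃ T : Fin r → G.Subgraph, (∀ i, IsSTree G S (T i)) ∧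
    ∀ i j, i ≠ j →
      (T i).verts ∩ (T j).verts = S ∧ (T i).edgeSet ∩ (T j).edgeSet = ∅

/-- `κ_G(S)`: the maximum number of pairwise internally edge disjoint `S`-trees. -/
noncomputable def treeConn {V : Type*} (G : SimpleGraph V) (S : Set V) : ℕ :=
  sSup {r | HasIEDTrees G S r}

/-- The generalized `k`-connectivity `κ_k(G)`. -/
noncomputable def gconn {V : Type*} (G : SimpleGraph V) (k : ℕ) : ℕ :=
  sInf {m | ∃ S : Finset V, S.card = k ∧ m = treeConn G (S : Set V)}

namespace SimpleGraph

variable {V : Type*} {G : SimpleGraph V}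

lemma Subgraph.coe_deleteVerts_isTree {T : G.Subgraph} (hT : T.coe.IsTree) {v w : V}
    (hv : (T.neighborSet v).Subsingleton) (hw : w ∈ T.verts) (hwv : w ≠ v) :
    (T.deleteVerts {v}).coe.IsTree := by
  refine ⟨?_, hT.2.comap (Subgraph.inclusion Subgraph.deleteVerts_le)
    (Subgraph.inclusion.injective _)⟩
  have hpre : (T.coe.induce {x : T.verts | (x : V) ≠ v}).Preconnected := by
    refine hT.1.preconnected.induce_of_degree_eq_one fun x hx a ha b hb => ?_
    have hxv : (x : V) = v := by simpa using hx
    have ha' : T.Adj x a := ha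
    have hb' : T.Adj x b := hb
    rw [hxv] at ha' hb'
    exact Subtype.ext (hv ha' hb')
  have hcon : (T.coe.induce {x : T.verts | (x : V) ≠ v}).Connected :=
    (connected_iff _).2 ⟨hpre, ⟨⟨⟨w, hw⟩, hwv⟩⟩⟩
  let f : T.coe.induce {x : T.verts | (x : V) ≠ v} →g (T.deleteVerts {v}).coe :=
    { toFun := fun x => ⟨x.1.1, x.1.2, x.2⟩
      map_rel' := by
        intro x y hxy
        have hxy' : T.Adj x.1.1 y.1.1 := hxy
        exact Subgraph.deleteVerts_adj.2 ⟨x.1.2, x.2, y.1.2, y.2, hxy'⟩ }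
  exact hcon.map f fun y => ⟨⟨⟨y.1, y.2.1⟩, y.2.2⟩, rfl⟩

end SimpleGraph

section

variable {V : Type*} {G : SimpleGraph V} {S : Set V}

lemma IsSTree.exists_adj {T : G.Subgraph} (hT : IsSTree G S T) (hS : S.Nontrivial) {v : V}
    (hv : v ∈ S) : ∃ w, T.Adj v w := by
  obtain ⟨u, hu, huv⟩ := hS.exists_ne v
  have : Nontrivial T.verts := ⟨⟨⟨u, hT.2 hu⟩, ⟨v, hT.2 hv⟩, fun h => huv (congrArg Subtype.val h)⟩⟩
  obtain ⟨w, hw⟩ := hT.1.1.preconnected.exists_adj_of_nontrivial ⟨v, hT.2 hv⟩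
  exact ⟨w, hw⟩

variable {m : ℕ} {T : Fin m → G.Subgraph}

lemma eq_of_adj_of_edgeSet_disjoint
    (hE : ∀ i j, i ≠ j → (T i).edgeSet ∩ (T j).edgeSet = ∅) {i j : Fin m} {v w : V}
    (hi : (T i).Adj v w) (hj : (T j).Adj v w) : i = j := by
  by_contra hij
  exact Set.eq_empty_iff_forall_notMem.1 (hE i j hij) s(v, w) ⟨hi, hj⟩

lemma injective_of_adj_of_edgeSet_disjoint
    (hE : ∀ i j, i ≠ j → (T i).edgeSet ∩ (T j).edgeSet = ∅) {v : V} {f : Fin m → V}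
    (hf : ∀ i, (T i).Adj v (f i)) : Function.Injective f := fun i j hij =>
  eq_of_adj_of_edgeSet_disjoint hE (hf i) (hij ▸ hf j)

section Fintype

variable [Fintype V] [DecidableRel G.Adj]

lemma HasIEDTrees.le_degree (h : HasIEDTrees G S m) (hS : S.Nontrivial) {v : V} (hv : v ∈ S) :
    m ≤ G.degree v := by
  classical
  obtain ⟨T, hT, hd⟩ := h
  choose f hf using fun i => (hT i).exists_adj hS hv
  have hinj := injective_of_adj_of_edgeSet_disjoint (fun i j hij => (hd i j hij).2) hf
  calc m = (Finset.univ.image f).card := by simp [Finset.card_image_of_injective _ hinj]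
    _ ≤ G.degree v := Finset.card_le_card fun w hw => by
      obtain ⟨i, -, rfl⟩ := Finset.mem_image.1 hw
      exact (G.mem_neighborFinset _ _).2 (hf i).adj_sub

/-- If there are at least as many trees as edges at `v`, each tree has exactly one edge at `v`
and every edge at `v` is used. -/
lemma exists_adj_and_subsingleton_of_degree_le (hT : ∀ i, IsSTree G S (T i))
    (hE : ∀ i j, i ≠ j → (T i).edgeSet ∩ (T j).edgeSet = ∅) (hS : S.Nontrivial) {v : V}
    (hv : v ∈ S) (hdeg : G.degree v ≤ m) :
    (∀ w, G.Adj v w → ∃ i, (T i).Adj v w) ∧ ∀ i, ((T i).neighborSet v).Subsingleton := by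
  classical
  choose f hf using fun i => (hT i).exists_adj hS hv
  have hinj := injective_of_adj_of_edgeSet_disjoint hE hf
  have himage : Finset.univ.image f = G.neighborFinset v := by
    refine Finset.eq_of_subset_of_card_le (fun w hw => ?_) ?_
    · obtain ⟨i, -, rfl⟩ := Finset.mem_image.1 hw
      exact (G.mem_neighborFinset _ _).2 (hf i).adj_sub
    · simpa [Finset.card_image_of_injective _ hinj] using hdeg
  have hsurj : ∀ w, G.Adj v w → ∃ i, f i = w := fun w hw => by
    have hmem := (G.mem_neighborFinset v w).2 hw
    simpa [← himage] using hmem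
  have hunique : ∀ i w, (T i).Adj v w → w = f i := fun i w hw => by
    obtain ⟨j, rfl⟩ := hsurj w hw.adj_sub
    rw [eq_of_adj_of_edgeSet_disjoint hE hw (hf j)]
  refine ⟨fun w hw => ?_, fun i a ha b hb => (hunique i a ha).trans (hunique i b hb).symm⟩
  obtain ⟨i, rfl⟩ := hsurj w hw
  exact ⟨i, hf i⟩

lemma neighborSet_subsingleton_or_of_degree_le (hT : ∀ i, IsSTree G S (T i))
    (hE : ∀ i j, i ≠ j → (T i).edgeSet ∩ (T j).edgeSet = ∅) (hS : S.Nontrivial) {v : V}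
    (hv : v ∈ S) (hdeg : G.degree v ≤ m + 1) {i j : Fin m} (hij : i ≠ j) :
    ((T i).neighborSet v).Subsingleton ∨ ((T j).neighborSet v).Subsingleton := by
  classical
  choose f hf using fun i => (hT i).exists_adj hS hv
  have hinj := injective_of_adj_of_edgeSet_disjoint hE hf
  by_contra! hcon
  obtain ⟨x, hx, hxf⟩ := hcon.1.exists_ne (f i)
  obtain ⟨y, hy, hyf⟩ := hcon.2.exists_ne (f j)
  have hximage : x ∉ insert y (Finset.univ.image f) := by
    simp only [Finset.mem_insert, Finset.mem_image, Finset.mem_univ, true_and, not_or, not_exists]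
    refine ⟨?_, ?_⟩
    · rintro rfl
      exact hij (eq_of_adj_of_edgeSet_disjoint hE hx hy)
    · rintro l rfl
      exact hxf (by rw [eq_of_adj_of_edgeSet_disjoint hE hx (hf l)])
  have hyimage : y ∉ Finset.univ.image f := by
    simp only [Finset.mem_image, Finset.mem_univ, true_and, not_exists]
    rintro l rfl
    exact hyf (by rw [eq_of_adj_of_edgeSet_disjoint hE hy (hf l)])
  have hsub : insert x (insert y (Finset.univ.image f)) ⊆ G.neighborFinset v := by
    intro w hw
    rw [G.mem_neighborFinset]
    simp only [Finset.mem_insert, Finset.mem_image, Finset.mem_univ, true_and] at hw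
    obtain rfl | rfl | ⟨l, rfl⟩ := hw
    exacts [hx.adj_sub, hy.adj_sub, (hf l).adj_sub]
  have hcard := Finset.card_le_card hsub
  rw [Finset.card_insert_of_notMem hximage, Finset.card_insert_of_notMem hyimage,
    Finset.card_image_of_injective _ hinj, G.card_neighborFinset_eq_degree, Finset.card_univ,
    Fintype.card_fin] at hcard
  omega

lemma HasIEDTrees.lt_of_adj (h : HasIEDTrees G S m) {u v w : V} (hu : u ∈ S) (hv : v ∈ S)
    (hw : w ∈ S) (huv : G.Adj u v) (hwu : w ≠ u) (hwv : w ≠ v) {r : ℕ} (hdu : G.degree u ≤ r)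
    (hdv : G.degree v ≤ r) : m < r := by
  by_contra! hr
  obtain ⟨T, hT, hd⟩ := h
  have hS : S.Nontrivial := ⟨u, hu, v, hv, huv.ne⟩
  have hE : ∀ i j, i ≠ j → (T i).edgeSet ∩ (T j).edgeSet = ∅ := fun i j hij => (hd i j hij).2
  obtain ⟨hcover, hsu⟩ :=
    exists_adj_and_subsingleton_of_degree_le hT hE hS hu (hdu.trans hr)
  obtain ⟨-, hsv⟩ := exists_adj_and_subsingleton_of_degree_le hT hE hS hv (hdv.trans hr)
  obtain ⟨i, hi⟩ := hcover v huv
  have hclosed : ∀ x : (T i).verts,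
      Relation.ReflTransGen (T i).coe.Adj ⟨u, (hT i).2 hu⟩ x → (x : V) = u ∨ (x : V) = v := by
    intro x hx
    induction hx with
    | refl => exact Or.inl rfl
    | @tail b c _ hbc ih =>
      have hbc' : (T i).Adj b c := hbc
      rcases ih with hb | hb <;> rw [hb] at hbc'
      · exact Or.inr (hsu i hbc' hi)
      · exact Or.inl (hsv i hbc' hi.symm)
  have hreach := (SimpleGraph.reachable_iff_reflTransGen _ _).1
    ((hT i).1.1.preconnected ⟨u, (hT i).2 hu⟩ ⟨w, (hT i).2 hw⟩)
  exact (hclosed _ hreach).elim hwu hwv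

lemma HasIEDTrees.of_insert {v : V} (hvS : v ∉ S) (hS : S.Nonempty)
    (h : HasIEDTrees G (insert v S) m) (hdeg : G.degree v ≤ m + 1) : HasIEDTrees G S m := by
  classical
  obtain ⟨T, hT, hd⟩ := h
  obtain ⟨w, hw⟩ := hS
  have hwv : w ≠ v := fun hwv => hvS (hwv ▸ hw)
  have hnt : (insert v S).Nontrivial := ⟨w, Or.inr hw, v, Or.inl rfl, hwv⟩
  have hss {i j : Fin m} (hij : i ≠ j) :=
    neighborSet_subsingleton_or_of_degree_le hT (fun i j hij => (hd i j hij).2) hnt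
      (Or.inl rfl : v ∈ insert v S) hdeg hij
  let T' : Fin m → G.Subgraph := fun i =>
    if ((T i).neighborSet v).Subsingleton then (T i).deleteVerts {v} else T i
  have hle : ∀ i, T' i ≤ T i := fun i => by
    dsimp only [T']
    split_ifs
    exacts [SimpleGraph.Subgraph.deleteVerts_le, le_rfl]
  have hnotMem : ∀ i, ((T i).neighborSet v).Subsingleton → v ∉ (T' i).verts := fun i hi => by
    simp [T', hi]
  have hST' : ∀ i, IsSTree G S (T' i) := fun i => by
    have hSi : S ⊆ (T i).verts := fun x hx => (hT i).2 (Or.inr hx)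
    dsimp only [T']
    split_ifs with hi
    · exact ⟨SimpleGraph.Subgraph.coe_deleteVerts_isTree (hT i).1 hi (hSi hw) hwv,
        fun x hx => ⟨hSi hx, fun hxv => hvS (hxv ▸ hx)⟩⟩
    · exact ⟨(hT i).1, hSi⟩
  refine ⟨T', hST', fun i j hij => ⟨?_, ?_⟩⟩
  · refine Set.Subset.antisymm (fun x hx => ?_) fun x hx => ⟨(hST' i).2 hx, (hST' j).2 hx⟩
    have hx' : x ∈ insert v S := (hd i j hij).1 ▸ ⟨(hle i).1 hx.1, (hle j).1 hx.2⟩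
    refine hx'.resolve_left ?_
    rintro rfl
    exact (hss hij).elim (fun hi => hnotMem i hi hx.1) fun hj => hnotMem j hj hx.2
  · exact Set.subset_empty_iff.1 ((hd i j hij).2 ▸ Set.inter_subset_inter
      (SimpleGraph.Subgraph.edgeSet_mono (hle i)) (SimpleGraph.Subgraph.edgeSet_mono (hle j)))

end Fintype

lemma HasIEDTrees.mono {n : ℕ} (h : HasIEDTrees G S n) (hmn : m ≤ n) : HasIEDTrees G S m := by
  obtain ⟨T, hT, hd⟩ := h
  exact ⟨T ∘ Fin.castLE hmn, fun i => hT _, fun i j hij =>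
    hd _ _ ((Fin.castLE_injective hmn).ne hij)⟩

lemma hasIEDTrees_zero : HasIEDTrees G S 0 :=
  ⟨Fin.elim0, fun i => i.elim0, fun i => i.elim0⟩

lemma bddAbove_hasIEDTrees [Finite V] (hS : S.Nontrivial) : BddAbove {m | HasIEDTrees G S m} := by
  classical
  have := Fintype.ofFinite V
  exact ⟨G.degree hS.nonempty.some, fun _ h => h.le_degree hS hS.nonempty.some_mem⟩

lemma le_treeConn_iff [Finite V] (hS : S.Nontrivial) :
    m ≤ treeConn G S ↔ HasIEDTrees G S m :=
  ⟨fun h => HasIEDTrees.mono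
    (Nat.sSup_mem (s := {m | HasIEDTrees G S m}) ⟨0, hasIEDTrees_zero⟩
      (bddAbove_hasIEDTrees hS)) h,
    fun h => le_csSup (bddAbove_hasIEDTrees hS) h⟩

lemma gconn_le_treeConn {k : ℕ} {S : Finset V} (hS : S.card = k) :
    gconn G k ≤ treeConn G (S : Set V) :=
  Nat.sInf_le ⟨S, hS, rfl⟩

lemma le_gconn {k : ℕ} {S : Finset V} (hS : S.card = k)
    (h : ∀ S : Finset V, S.card = k → m ≤ treeConn G (S : Set V)) : m ≤ gconn G k := by
  refine le_csInf ⟨_, S, hS, rfl⟩ ?_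
  rintro _ ⟨S, hS, rfl⟩
  exact h S hS

lemma gconn_eq_zero_of_card_lt [Fintype V] {k : ℕ} (h : Fintype.card V < k) : gconn G k = 0 := by
  refine Nat.sInf_eq_zero.2 (Or.inr (Set.eq_empty_iff_forall_notMem.2 ?_))
  rintro _ ⟨S, hS, -⟩
  exact absurd (S.card_le_univ) (by omega)

lemma Finset.coe_nontrivial_of_two_le_card {S : Finset V} (hS : 2 ≤ S.card) :
    (S : Set V).Nontrivial :=
  Finset.one_lt_card_iff_nontrivial.1 hS

variable [Fintype V] [DecidableRel G.Adj] {k r : ℕ}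

lemma gconn_le_pred_of_regular (hreg : ∀ v, G.degree v = r) (hk : 3 ≤ k)
    (hcard : k ≤ Fintype.card V) : gconn G k ≤ r - 1 := by
  classical
  obtain ⟨u⟩ : Nonempty V := Fintype.card_pos_iff.1 (by omega)
  obtain rfl | hr := Nat.eq_zero_or_pos r
  · obtain ⟨S, -, hS⟩ := Finset.exists_subset_card_eq (s := (Finset.univ : Finset V)) hcard
    have hnt := Finset.coe_nontrivial_of_two_le_card (S := S) (by omega)
    obtain ⟨v, hv⟩ := hnt.nonempty
    exact (gconn_le_treeConn hS).trans
      ((((le_treeConn_iff hnt).1 le_rfl).le_degree hnt hv).trans (hreg v).le)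
  obtain ⟨v, huv⟩ := (G.degree_pos_iff_exists_adj u).1 (by rw [hreg u]; exact hr)
  have hpair : ({u, v} : Finset V).card = 2 := Finset.card_pair huv.ne
  obtain ⟨S, hsub, -, hS⟩ := Finset.exists_subsuperset_card_eq
    (Finset.subset_univ ({u, v} : Finset V)) (by omega) hcard
  obtain ⟨w, hw, hwuv⟩ := Finset.exists_mem_notMem_of_card_lt_card
    (show ({u, v} : Finset V).card < S.card by omega)
  simp only [Finset.mem_insert, Finset.mem_singleton, not_or] at hwuv
  have hnt := Finset.coe_nontrivial_of_two_le_card (S := S) (by omega)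
  have hlt := ((le_treeConn_iff (G := G) hnt).1 le_rfl).lt_of_adj
    (hsub (Finset.mem_insert_self u {v}))
    (hsub (Finset.mem_insert_of_mem (Finset.mem_singleton_self v))) hw huv hwuv.1 hwuv.2
    (hreg u).le (hreg v).le
  have := gconn_le_treeConn (G := G) hS
  omega

lemma pred_le_gconn_of_regular (hreg : ∀ v, G.degree v = r) (hk : 2 ≤ k)
    (hcard : k < Fintype.card V) (h : r - 1 ≤ gconn G (k + 1)) : r - 1 ≤ gconn G k := by
  classical
  obtain ⟨S₀, -, hS₀⟩ := Finset.exists_subset_card_eq (s := (Finset.univ : Finset V)) hcard.le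
  refine le_gconn hS₀ fun S hS => ?_
  have hnt := Finset.coe_nontrivial_of_two_le_card (S := S) (by omega)
  obtain ⟨v, -, hv⟩ := Finset.exists_mem_notMem_of_card_lt_card
    (show S.card < (Finset.univ : Finset V).card by rw [hS]; exact hcard)
  have hins : (insert v S).card = k + 1 := by rw [Finset.card_insert_of_notMem hv, hS]
  have htrees := (le_treeConn_iff (Finset.coe_nontrivial_of_two_le_card (by omega))).1
    (h.trans (gconn_le_treeConn hins))
  rw [Finset.coe_insert] at htrees
  exact (le_treeConn_iff hnt).2
    (htrees.of_insert (by simpa using hv) hnt.nonempty (by rw [hreg v]; omega))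

end

/-- for an `r`-regular graph `G` and `k ≥ 4`, if `κ_k(G) = r - 1`
then `κ_{k-1}(G) = r - 1`. -/
theorem gconn_pred_of_gconn_eq {V : Type*} [Fintype V]
    (G : SimpleGraph V) [DecidableRel G.Adj]
    (r : ℕ) (hreg : ∀ v : V, G.degree v = r)
    (k : ℕ) (hk : 4 ≤ k) (h : gconn G k = r - 1) :
    gconn G (k - 1) = r - 1 := by
  obtain ⟨k, rfl⟩ : ∃ l, k = l + 1 := ⟨k - 1, by omega⟩
  rw [Nat.add_sub_cancel]
  obtain hcard | rfl | hcard := lt_trichotomy (Fintype.card V) k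
  · rw [← h, gconn_eq_zero_of_card_lt hcard, gconn_eq_zero_of_card_lt (by omega)]
  · have hle := gconn_le_pred_of_regular hreg (by omega) le_rfl
    rw [gconn_eq_zero_of_card_lt (Nat.lt_succ_self _)] at h
    omega
  · exact (gconn_le_pred_of_regular hreg (by omega) hcard.le).antisymm
      (pred_le_gconn_of_regular hreg (by omega) hcard h.ge)
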